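/- arXiv:2006.03551 — 2 statements merged into one kernel-verified Lean document; each statement's English description precedes it below -/
import Mathlib

section
/- Let P be a Poisson algebra over a field 𝔽 of characteristic p ≥ 3. If P is solvable as a Lie algebra, then the Poisson ideal {P,P}·P is nil of bounded index: there exists a positive integer r such that x^r = 0 for every x ∈ {P,P}·P. -/
/-- A Poisson bracket on a commutative associative unital `F`-algebra `P`:
an `F`-bilinear, alternating bracket satisfying the Jacobi identity and the
Leibniz rule `{a·b, c} = a·{b,c} + b·{a,c}`. -/
structure PoissonBracket (F P : Type*) [Field F] [CommRing P] [Algebra F P] where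
  bracket : P → P → P
  add_left : ∀ a b c : P, bracket (a + b) c = bracket a c + bracket b c
  smul_left : ∀ (r : F) (a b : P), bracket (r • a) b = r • bracket a b
  add_right : ∀ a b c : P, bracket a (b + c) = bracket a b + bracket a c
  smul_right : ∀ (r : F) (a b : P), bracket a (r • b) = r • bracket a b
  alt : ∀ a : P, bracket a a = 0
  jacobi : ∀ a b c : P,
    bracket (bracket a b) c + bracket (bracket b c) a + bracket (bracket c a) b = 0
  leibniz : ∀ a b c : P, bracket (a * b) c = a * bracket b c + b * bracket a c

namespace PoissonBracket

variable {F P : Type*} [Field F] [CommRing P] [Algebra F P]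

/-- `{A, B}`: the `F`-span of all brackets of elements of `A` with elements of `B`. -/
def lieSpan (pb : PoissonBracket F P) (A B : Submodule F P) : Submodule F P :=
  Submodule.span F {z : P | ∃ a ∈ A, ∃ b ∈ B, z = pb.bracket a b}

/-- Upper derived series: `δ̃₀(P) = P`, `δ̃ₙ₊₁(P) = {δ̃ₙ(P), δ̃ₙ(P)}·P`. -/
def udelta (pb : PoissonBracket F P) : ℕ → Submodule F P
  | 0 => ⊤
  | n + 1 => pb.lieSpan (pb.udelta n) (pb.udelta n) * ⊤

/-- Derived series of a Lie ideal `I`: `δ₀(I) = I`, `δₙ₊₁(I) = {δₙ(I), δₙ(I)}`. -/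
def dseries (pb : PoissonBracket F P) (I : Submodule F P) : ℕ → Submodule F P
  | 0 => I
  | n + 1 => pb.lieSpan (pb.dseries I n) (pb.dseries I n)

/-- Lower central series of a Lie ideal `I`, indexed so that `lcs I 1 = γ₁(I) = I`
and `lcs I (n+1) = γₙ₊₁(I) = {γₙ(I), I}` for `n ≥ 1` (index `0` is a dummy equal to `I`). -/
def lcs (pb : PoissonBracket F P) (I : Submodule F P) : ℕ → Submodule F P
  | 0 => I
  | 1 => I
  | n + 2 => pb.lieSpan (pb.lcs I (n + 1)) I

/-- Upper Lie power series: `P⁽¹⁾ = P`, `P⁽ⁿ⁾ = {P⁽ⁿ⁻¹⁾, P}·P` for `n > 1`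
(index `0` is a dummy equal to `P`). -/
def ulps (pb : PoissonBracket F P) : ℕ → Submodule F P
  | 0 => ⊤
  | 1 => ⊤
  | n + 2 => pb.lieSpan (pb.ulps (n + 1)) ⊤ * ⊤

/-- A Poisson ideal: an ideal for the associative product which is also a Lie ideal. -/
def IsPoissonIdeal (pb : PoissonBracket F P) (I : Submodule F P) : Prop :=
  (∀ x ∈ I, ∀ p : P, p * x ∈ I) ∧ (∀ x ∈ I, ∀ p : P, pb.bracket x p ∈ I)

/-- The Poisson ideal generated by a set `S`: the smallest Poisson ideal containing `S`. -/
def poissonSpan (pb : PoissonBracket F P) (S : Set P) : Submodule F P :=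
  sInf {I : Submodule F P | pb.IsPoissonIdeal I ∧ S ⊆ I}

end PoissonBracket

open PoissonBracket

namespace PoissonBracket

variable {F P : Type*} [Field F] [CommRing P] [Algebra F P]

lemma skew (pb : PoissonBracket F P) (a b : P) : pb.bracket a b = - pb.bracket b a := by
  have h := pb.alt (a + b)
  rw [pb.add_left, pb.add_right, pb.add_right, pb.alt, pb.alt] at h
  linear_combination h

lemma zero_left (pb : PoissonBracket F P) (a : P) : pb.bracket 0 a = 0 := by
  have h := pb.add_left 0 0 a
  rw [add_zero] at h
  linear_combination -h

lemma leibniz_right (pb : PoissonBracket F P) (a b c : P) :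
    pb.bracket c (a * b) = a * pb.bracket c b + b * pb.bracket c a := by
  rw [pb.skew c, pb.leibniz, pb.skew b c, pb.skew a c]; ring

lemma bracket_mem (pb : PoissonBracket F P) {A B : Submodule F P} {a b : P}
    (ha : a ∈ A) (hb : b ∈ B) : pb.bracket a b ∈ pb.lieSpan A B :=
  Submodule.subset_span ⟨a, ha, b, hb, rfl⟩

/-- The terms of the derived series of `P` are Lie ideals. -/
lemma dseries_lie (pb : PoissonBracket F P) (n : ℕ) :
    ∀ x ∈ pb.dseries ⊤ n, ∀ r : P, pb.bracket x r ∈ pb.dseries ⊤ n := by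
  induction n with
  | zero => intro x _ r; exact Submodule.mem_top
  | succ n ih =>
    intro x hx r
    change x ∈ pb.lieSpan _ _ at hx
    change _ ∈ pb.lieSpan _ _
    unfold lieSpan at hx
    induction hx using Submodule.span_induction with
    | mem x h =>
      obtain ⟨a, ha, b, hb, rfl⟩ := h
      have e : pb.bracket (pb.bracket a b) r
          = pb.bracket a (pb.bracket b r) + pb.bracket (pb.bracket a r) b := by
        have h1 := pb.jacobi a b r
        have h2 := pb.skew (pb.bracket b r) a
        have h3 : pb.bracket (pb.bracket r a) b = - pb.bracket (pb.bracket a r) b := by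
          have h4 := pb.add_left (pb.bracket r a) (pb.bracket a r) b
          rw [pb.skew r a, neg_add_cancel, pb.zero_left] at h4
          rw [pb.skew r a]
          linear_combination -h4
        linear_combination h1 - h2 - h3
      rw [e]
      exact add_mem (pb.bracket_mem ha (ih b hb r)) (pb.bracket_mem (ih a ha r) hb)
    | zero => rw [pb.zero_left]; exact zero_mem _
    | add x y _ _ hx hy => rw [pb.add_left]; exact add_mem hx hy
    | smul c x _ hx => rw [pb.smul_left]; exact Submodule.smul_mem _ _ hx

/-- Key step: if `L` is a Lie ideal and `{L,L}` is central modulo `I`,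
then `{u,a}^4 ∈ I` for all `u ∈ L`. -/
lemma pow_four_mem (pb : PoissonBracket F P) (L : Submodule F P)
    (hL : ∀ x ∈ L, ∀ r : P, pb.bracket x r ∈ L) (I : Ideal P)
    (hI : ∀ x ∈ L, ∀ y ∈ L, ∀ r : P, pb.bracket (pb.bracket x y) r ∈ I)
    (h2 : IsUnit (2 : P)) (u : P) (hu : u ∈ L) (a : P) : pb.bracket u a ^ 4 ∈ I := by
  have hI' : ∀ x ∈ L, ∀ y ∈ L, ∀ r : P, pb.bracket r (pb.bracket x y) ∈ I := by
    intro x hx y hy r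
    rw [pb.skew]; exact neg_mem (hI x hx y hy r)
  have key : ∀ b r : P,
      pb.bracket u (pb.bracket u b) * pb.bracket u (pb.bracket u r) ∈ I := by
    intro b r
    have h1 := hI' _ (hL u hu b) _ (hL u hu (u * r)) u
    have h3 := I.mul_mem_left (pb.bracket u r) (hI' _ hu _ (hL u hu b) u)
    have h4 := I.mul_mem_left u (hI' _ (hL u hu b) _ (hL u hu r) u)
    have e : pb.bracket (pb.bracket u b) (pb.bracket u (u * r))
        = u * pb.bracket (pb.bracket u b) (pb.bracket u r)
          + pb.bracket u r * (-1 : F) • pb.bracket u (pb.bracket u b) := by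
      rw [pb.leibniz_right u r u, pb.alt, mul_zero, add_zero, pb.leibniz_right,
        pb.skew (pb.bracket u b) u, neg_one_smul]
    rw [e, pb.add_right, pb.leibniz_right, pb.leibniz_right, pb.alt, mul_zero, add_zero,
      pb.smul_right, neg_one_smul, neg_one_smul] at h1
    have := sub_mem (sub_mem h4 h3) h1
    convert this using 1
    ring
  have e : pb.bracket u (pb.bracket u (a * a)) - 2 * a * pb.bracket u (pb.bracket u a)
      = 2 * pb.bracket u a ^ 2 := by
    rw [pb.leibniz_right, pb.add_right, pb.leibniz_right]; ring
  have h := sub_mem (key (a * a) (a * a))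
    (sub_mem (I.mul_mem_left (4 * a) (key (a * a) a)) (I.mul_mem_left (4 * a ^ 2) (key a a)))
  have h4 : (2 * 2) * pb.bracket u a ^ 4 ∈ I := by
    convert h using 1
    linear_combination -(2 * pb.bracket u a ^ 2 + (pb.bracket u (pb.bracket u (a * a))
      - 2 * a * pb.bracket u (pb.bracket u a))) * e
  exact (Ideal.unit_mul_mem_iff_mem I (h2.mul h2)).1 h4

/-- The ideal `{L,P}·P`. -/
def cIdeal (pb : PoissonBracket F P) (L : Submodule F P) : Ideal P :=
  Ideal.span {z : P | ∃ u ∈ L, ∃ a : P, z = pb.bracket u a}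

lemma nil_of_gen (p : ℕ) [Fact p.Prime] [CharP P p] (m : ℕ) (S : Set P)
    (hS : ∀ x ∈ S, x ^ p ^ m = 0) : ∀ x ∈ Ideal.span S, x ^ p ^ m = 0 := by
  have hp : p ^ m ≠ 0 := pow_ne_zero _ (Fact.out : p.Prime).ne_zero
  intro x hx
  induction hx using Submodule.span_induction with
  | mem x h => exact hS x h
  | zero => exact zero_pow hp
  | add x y _ _ hx hy => rw [add_pow_char_pow, hx, hy, add_zero]
  | smul c x _ hx => rw [smul_eq_mul, mul_pow, hx, mul_zero]

lemma nil_step (p : ℕ) [Fact p.Prime] [CharP P p] (hp : 3 ≤ p) (pb : PoissonBracket F P)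
    (h2 : IsUnit (2 : P)) (k m : ℕ)
    (h : ∀ x ∈ pb.cIdeal (pb.dseries ⊤ (k + 1)), x ^ p ^ m = 0) :
    ∀ x ∈ pb.cIdeal (pb.dseries ⊤ k), x ^ p ^ (m + 2) = 0 := by
  apply nil_of_gen
  rintro x ⟨u, hu, a, rfl⟩
  have h4 := pb.pow_four_mem (pb.dseries ⊤ k) (pb.dseries_lie k)
    (pb.cIdeal (pb.dseries ⊤ (k + 1)))
    (fun x hx y hy r => Ideal.subset_span ⟨_, pb.bracket_mem hx hy, r, rfl⟩) h2 u hu a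
  have h5 := h _ h4
  rw [← pow_mul] at h5
  refine pow_eq_zero_of_le ?_ h5
  rw [pow_add, mul_comm]
  exact Nat.mul_le_mul_left _ (by nlinarith)

end PoissonBracket

/-- Over a field of characteristic `p ≥ 3`, if `P` is solvable as a Lie algebra then
the Poisson ideal `{P,P}·P` is nil of bounded index. -/
theorem solvable_lieSpan_mul_top_isNil_boundedIndex
    {F P : Type*} [Field F] [CommRing P] [Algebra F P]
    (p : ℕ) [CharP F p] (hp : 3 ≤ p)
    (pb : PoissonBracket F P)
    (hsolv : ∃ n : ℕ, pb.dseries ⊤ n = ⊥) :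
    ∃ r : ℕ, 0 < r ∧ ∀ x ∈ pb.lieSpan ⊤ ⊤ * (⊤ : Submodule F P), x ^ r = 0 := by
  obtain ⟨n, hn⟩ := hsolv
  rcases subsingleton_or_nontrivial P with hs | hs
  · exact ⟨1, one_pos, fun x _ => Subsingleton.elim _ _⟩
  have hprime : p.Prime := (CharP.char_is_prime_or_zero F p).resolve_right (by omega)
  have : Fact p.Prime := ⟨hprime⟩
  have : CharP P p := charP_of_injective_algebraMap (algebraMap F P).injective p
  have h2F : (2 : F) ≠ 0 := by
    intro h
    have h' : ((2 : ℕ) : F) = 0 := by exact_mod_cast h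
    have := Nat.le_of_dvd (by norm_num) ((CharP.cast_eq_zero_iff F p 2).1 h')
    omega
  have h2 : IsUnit (2 : P) := by
    have := (IsUnit.mk0 _ h2F).map (algebraMap F P)
    rwa [map_ofNat] at this
  have main : ∀ j ≤ n, ∃ m, ∀ x ∈ pb.cIdeal (pb.dseries ⊤ (n - j)), x ^ p ^ m = 0 := by
    intro j
    induction j with
    | zero =>
      intro _
      refine ⟨0, nil_of_gen p 0 _ ?_⟩
      rintro x ⟨u, hu, a, rfl⟩
      rw [Nat.sub_zero, hn, Submodule.mem_bot] at hu
      rw [hu, pb.zero_left]; simp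
    | succ j ih =>
      intro hj
      obtain ⟨m, hm⟩ := ih (by omega)
      refine ⟨m + 2, pb.nil_step p hp h2 _ m ?_⟩
      rwa [show n - (j + 1) + 1 = n - j by omega]
  obtain ⟨m, hm⟩ := main n le_rfl
  rw [Nat.sub_self] at hm
  refine ⟨p ^ m, pow_pos hprime.pos m, fun x hx => hm x ?_⟩
  have hle : pb.lieSpan ⊤ ⊤ ≤ (pb.cIdeal (pb.dseries ⊤ 0)).restrictScalars F := by
    refine Submodule.span_le.2 ?_
    rintro z ⟨a, ha, b, _, rfl⟩
    exact Ideal.subset_span ⟨a, ha, b, rfl⟩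
  induction hx using Submodule.mul_induction_on' with
  | mem_mul_mem y hy c _ => exact Ideal.mul_mem_right _ _ (hle hy)
  | add y _ z _ hy hz => exact add_mem hy hz
end

section
/- Let P be a Poisson algebra over a field 𝔽 that is solvable of derived length n ≥ 2 as a Lie algebra. Then ({δ₂(P), P})^t = 0, where t = 15^{n−2} + (3/2)·(15^{n−2} − 1); that is, every product of t elements of the subspace {δ₂(P), P} vanishes. -/
open PoissonBracket

namespace PoissonBracket

section basics
variable {F P : Type*} [Field F] [CommRing P] [Algebra F P] (pb : PoissonBracket F P)

theorem zero_l (b : P) : pb.bracket 0 b = 0 := by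
  have := pb.add_left 0 0 b
  simpa using this

theorem zero_r (b : P) : pb.bracket b 0 = 0 := by
  have := pb.add_right b 0 0
  simpa using this

theorem anti (a b : P) : pb.bracket a b = - pb.bracket b a := by
  have h := pb.alt (a + b)
  rw [pb.add_left, pb.add_right, pb.add_right, pb.alt, pb.alt] at h
  linear_combination h

theorem neg_l (a b : P) : pb.bracket (-a) b = - pb.bracket a b := by
  have h := pb.add_left a (-a) b
  rw [add_neg_cancel, pb.zero_l] at h
  linear_combination -h

theorem neg_r (a b : P) : pb.bracket a (-b) = - pb.bracket a b := by
  have h := pb.add_right a b (-b)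
  rw [add_neg_cancel, pb.zero_r] at h
  linear_combination -h

theorem leib_r (a b c : P) : pb.bracket a (b * c) = b * pb.bracket a c + c * pb.bracket a b := by
  rw [pb.anti a (b * c), pb.leibniz, pb.anti b a, pb.anti c a]
  ring

theorem mem_lieSpan {A B : Submodule F P} {a b : P} (ha : a ∈ A) (hb : b ∈ B) :
    pb.bracket a b ∈ pb.lieSpan A B :=
  Submodule.subset_span ⟨a, ha, b, hb, rfl⟩

/-- Jacobi as a derivation rule. -/
theorem jac (a b c : P) : pb.bracket a (pb.bracket b c) =
    pb.bracket (pb.bracket a b) c + pb.bracket b (pb.bracket a c) := by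
  have h := pb.jacobi a b c
  rw [pb.anti (pb.bracket b c) a, pb.anti (pb.bracket c a) b, pb.anti c a, pb.neg_r] at h
  linear_combination -h

/-- Lie ideal. -/
def LieId (L : Submodule F P) : Prop := ∀ x ∈ L, ∀ p : P, pb.bracket x p ∈ L

theorem LieId.right {pb : PoissonBracket F P} {L : Submodule F P} (hL : pb.LieId L)
    {x : P} (hx : x ∈ L) (p : P) : pb.bracket p x ∈ L := by
  rw [pb.anti]
  exact L.neg_mem (hL x hx p)

theorem LieId.span {pb : PoissonBracket F P} {A B : Submodule F P} (hA : pb.LieId A)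
    (hB : pb.LieId B) : pb.LieId (pb.lieSpan A B) := by
  intro x hx p
  induction hx using Submodule.span_induction with
  | mem x h =>
    obtain ⟨a, ha, b, hb, rfl⟩ := h
    have h := pb.jac p a b
    rw [pb.anti, h]
    exact Submodule.neg_mem _ (Submodule.add_mem _ (pb.mem_lieSpan (hA.right ha p) hb)
      (pb.mem_lieSpan ha (hB.right hb p)))
  | zero => rw [pb.zero_l]; exact Submodule.zero_mem _
  | add x y _ _ h1 h2 => rw [pb.add_left]; exact Submodule.add_mem _ h1 h2
  | smul r x _ h => rw [pb.smul_left]; exact Submodule.smul_mem _ r h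

theorem lieId_top : pb.LieId (⊤ : Submodule F P) := fun _ _ _ => Submodule.mem_top

theorem lieId_dseries (k : ℕ) : pb.LieId (pb.dseries ⊤ k) := by
  induction k with
  | zero => exact pb.lieId_top
  | succ k ih => exact ih.span ih

/-- `{ {L,L}P, P } ⊆ L`. -/
theorem key_mem {L : Submodule F P} (hL : pb.LieId L) {a : P} (ha : a ∈ pb.lieSpan L L)
    (p q : P) : pb.bracket (a * p) q ∈ L := by
  have hmul : ∀ x y : P, (∀ r, pb.bracket x r ∈ L) → (∀ r, pb.bracket y r ∈ L) →
      ∀ r, pb.bracket (x * y) r ∈ L := by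
    intro x y hx hy r
    have e : pb.bracket (x * y) r = pb.bracket x (y * r) + pb.bracket y (x * r) := by
      rw [pb.leibniz, pb.leib_r, pb.leib_r, pb.anti y x]
      ring
    rw [e]
    exact L.add_mem (hx _) (hy _)
  induction ha using Submodule.span_induction with
  | mem x h =>
    obtain ⟨l, hl, m, hm, rfl⟩ := h
    have e : pb.bracket l m * p = pb.bracket l (m * p) + -(m * pb.bracket l p) := by
      rw [pb.leib_r]; ring
    rw [e, pb.add_left, pb.neg_l]
    exact L.add_mem (hL _ (hL _ hl _) _)
      (L.neg_mem (hmul _ _ (hL _ hm) (hL _ (hL _ hl _)) _))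
  | zero => rw [zero_mul, pb.zero_l]; exact Submodule.zero_mem _
  | add x y _ _ h1 h2 => rw [add_mul, pb.add_left]; exact Submodule.add_mem _ h1 h2
  | smul r x _ h =>
    rw [smul_mul_assoc, pb.smul_left]; exact Submodule.smul_mem _ r h

/-- ideal generated by `{A,B}` -/
def brId (A B : Submodule F P) : Ideal P :=
  Ideal.span {z : P | ∃ a ∈ A, ∃ b ∈ B, z = pb.bracket a b}

theorem mem_brId {A B : Submodule F P} {a b : P} (ha : a ∈ A) (hb : b ∈ B) :
    pb.bracket a b ∈ pb.brId A B :=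
  Ideal.subset_span ⟨a, ha, b, hb, rfl⟩

theorem brId_closed {A B : Submodule F P} (hA : pb.LieId A) (hB : pb.LieId B) :
    ∀ x ∈ pb.brId A B, ∀ p : P, pb.bracket x p ∈ pb.brId A B := by
  intro x hx p
  induction hx using Submodule.span_induction with
  | mem x h =>
    obtain ⟨a, ha, b, hb, rfl⟩ := h
    rw [pb.anti, pb.jac p a b]
    exact Submodule.neg_mem _ (Submodule.add_mem _ (pb.mem_brId (hA.right ha p) hb)
      (pb.mem_brId ha (hB.right hb p)))
  | zero => rw [pb.zero_l]; exact Submodule.zero_mem _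
  | add x y _ _ h1 h2 => rw [pb.add_left]; exact Submodule.add_mem _ h1 h2
  | smul r x hx h =>
    rw [smul_eq_mul, pb.leibniz]
    exact Ideal.add_mem _ (Ideal.mul_mem_left _ _ h) (Ideal.mul_mem_right _ _ hx)

/-- The combinatorial lemma: antisymmetry kills the product. -/
theorem alt_kill {L : Submodule F P} (g : P)
    (h1 : ∀ a ∈ pb.lieSpan L L, ∀ b ∈ pb.lieSpan L L, ∀ p q : P,
      g * (pb.bracket a p * pb.bracket b q + pb.bracket a q * pb.bracket b p) = 0)
    (h2 : ∀ a ∈ pb.lieSpan L L, ∀ x ∈ L, ∀ x' ∈ L, ∀ y ∈ L, ∀ s : P,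
      g * (pb.bracket a x * pb.bracket (pb.bracket x' y) s +
        pb.bracket a x' * pb.bracket (pb.bracket x y) s) = 0)
    {a e x : P} (ha : a ∈ pb.lieSpan L L) (he : e ∈ pb.lieSpan L L) (hx : x ∈ L) (s : P) :
    g * (pb.bracket a x * pb.bracket e s) = 0 := by
  have main : ∀ u ∈ L, ∀ v ∈ L, ∀ x ∈ L, ∀ y ∈ L, ∀ z ∈ L,
      g * (pb.bracket (pb.bracket u v) x * pb.bracket (pb.bracket y z) s) = 0 := by
    set T : P → P → P → P → P → P := fun u v x y z =>
      g * (pb.bracket (pb.bracket u v) x * pb.bracket (pb.bracket y z) s) with hT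
    have t12 : ∀ u v x y z, T u v x y z = - T v u x y z := by
      intro u v x y z
      simp only [hT]
      rw [pb.anti u v, pb.neg_l]; ring
    have t45 : ∀ u v x y z, T u v x y z = - T u v x z y := by
      intro u v x y z
      simp only [hT]
      rw [pb.anti y z, pb.neg_l]; ring
    have t34 : ∀ u ∈ L, ∀ v ∈ L, ∀ x ∈ L, ∀ y ∈ L, ∀ z ∈ L, T u v x y z = - T u v y x z := by
      intro u hu v hv x hx y hy z hz
      have := h2 _ (pb.mem_lieSpan hu hv) x hx y hy z hz s
      simp only [hT]
      linear_combination this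
    have tsw : ∀ u ∈ L, ∀ v ∈ L, ∀ x ∈ L, ∀ y ∈ L, ∀ z ∈ L, T u v x y z = - T y z x u v := by
      intro u hu v hv x hx y hy z hz
      have := h1 _ (pb.mem_lieSpan hu hv) _ (pb.mem_lieSpan hy hz) x s
      simp only [hT]
      linear_combination this
    have t13 : ∀ u ∈ L, ∀ v ∈ L, ∀ x ∈ L, ∀ y ∈ L, ∀ z ∈ L, T u v x y z = - T x v u y z := by
      intro u hu v hv x hx y hy z hz
      rw [tsw u hu v hv x hx y hy z hz, t34 y hy z hz x hx u hu v hv,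
        tsw x hx v hv u hu y hy z hz]
    intro u hu v hv x hx y hy z hz
    -- three times
    have three : T u v x y z + T u v y z x + T u v z x y = 0 := by
      have e1 := h1 _ (pb.mem_lieSpan hu hv) _ (pb.mem_lieSpan hy hz) x s
      have e2 := h1 _ (pb.mem_lieSpan hu hv) _ (pb.mem_lieSpan hz hx) y s
      have e3 := h1 _ (pb.mem_lieSpan hu hv) _ (pb.mem_lieSpan hx hy) z s
      have j := pb.jacobi y z x
      simp only [hT]
      linear_combination e1 + e2 + e3 - g * pb.bracket (pb.bracket u v) s * j
    have c1 : T u v y z x = T u v x y z := by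
      rw [t45 u v y z x, t34 u hu v hv y hy x hx z hz, neg_neg]
    have c2 : T u v z x y = T u v x y z := by
      rw [t34 u hu v hv z hz x hx y hy, t45 u v x z y, neg_neg]
    -- twice: move (u v) past (y z)
    have d1 : T y z x u v = T u v x y z := by
      rw [t13 y hy z hz x hx u hu v hv, t34 x hx z hz y hy u hu v hv,
        t13 x hx z hz u hu y hy v hv, t12 u z x y v, t13 z hz u hu x hx y hy v hv,
        t45 x u z y v, t34 x hx u hu z hz v hv y hy, t45 x u v z y,
        t13 x hx u hu v hv y hy z hz, t12 v u x y z]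
      ring
    have d2 := tsw u hu v hv x hx y hy z hz
    have : T u v x y z = 0 := by
      linear_combination three - c1 - c2 - d2 + d1
    exact this
  -- extend linearly
  have step : ∀ u ∈ L, ∀ v ∈ L, ∀ x ∈ L,
      g * (pb.bracket (pb.bracket u v) x * pb.bracket e s) = 0 := by
    intro u hu v hv x hx
    induction he using Submodule.span_induction with
    | mem e h =>
      obtain ⟨y, hy, z, hz, rfl⟩ := h
      exact main u hu v hv x hx y hy z hz
    | zero => rw [pb.zero_l]; ring
    | add e f _ _ k1 k2 => rw [pb.add_left]; linear_combination k1 + k2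
    | smul r e _ k => rw [pb.smul_left, mul_smul_comm, mul_smul_comm, k, smul_zero]
  induction ha using Submodule.span_induction with
  | mem a h =>
    obtain ⟨y, hy, z, hz, rfl⟩ := h
    exact step y hy z hz x hx
  | zero => rw [pb.zero_l]; ring
  | add e f _ _ k1 k2 => rw [pb.add_left]; linear_combination k1 + k2
  | smul r e _ k => rw [pb.smul_left, smul_mul_assoc, mul_smul_comm, k, smul_zero]

/-- `{A,P}^3 ⊆ {A,L}P + {A,A}P` -/
theorem cube_le {L A : Submodule F P} (hL : pb.LieId L) (hA : A = pb.lieSpan L L) :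
    pb.brId A ⊤ ^ 3 ≤ pb.brId A L ⊔ pb.brId A A := by
  have hAL : pb.LieId A := hA ▸ hL.span hL
  rw [pow_succ, pow_two]
  unfold brId
  rw [Ideal.span_mul_span', Ideal.span_mul_span', Ideal.span_le]
  rintro _ ⟨_, ⟨_, ⟨b, hb, p, -, rfl⟩, _, ⟨a, ha, r, -, rfl⟩, rfl⟩, _, ⟨d, hd, s, -, rfl⟩, rfl⟩
  change pb.bracket b p * pb.bracket a r * pb.bracket d s ∈ pb.brId A L ⊔ pb.brId A A
  have hb' : pb.bracket b p ∈ A := hAL b hb p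
  generalize pb.bracket b p = b at hb'
  have e : b * pb.bracket a r * pb.bracket d s =
      (pb.bracket a (pb.bracket (b * (r * d)) s) - d * pb.bracket a (pb.bracket (b * r) s))
      - (r * pb.bracket d s * pb.bracket a b + b * r * pb.bracket a (pb.bracket d s)
        + pb.bracket (b * r) s * pb.bracket a d) := by
    simp only [pb.leibniz, pb.leib_r, pb.add_right]
    ring
  rw [e]
  have hbA : b ∈ pb.lieSpan L L := hA ▸ hb'
  refine Ideal.sub_mem _ (Ideal.mem_sup_left (Ideal.sub_mem _ ?_ (Ideal.mul_mem_left _ _ ?_)))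
    (Ideal.mem_sup_right (Ideal.add_mem _ (Ideal.add_mem _ (Ideal.mul_mem_left _ _ ?_)
      (Ideal.mul_mem_left _ _ ?_)) (Ideal.mul_mem_left _ _ ?_)))
  · exact pb.mem_brId ha (pb.key_mem hL hbA _ _)
  · exact pb.mem_brId ha (pb.key_mem hL hbA _ _)
  · exact pb.mem_brId ha hb'
  · exact pb.mem_brId ha (hAL d hd s)
  · exact pb.mem_brId ha hd

/-- Abelian case. -/
theorem core1 {L A : Submodule F P} (hL : pb.LieId L) (hA : A = pb.lieSpan L L)
    (hab : ∀ a ∈ A, ∀ b ∈ A, pb.bracket a b = 0) : pb.brId A ⊤ ^ 10 = ⊥ := by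
  have hAL : pb.LieId A := hA ▸ hL.span hL
  have hLL : ∀ x ∈ L, ∀ y ∈ L, pb.bracket x y ∈ A := by
    intro x hx y hy; rw [hA]; exact pb.mem_lieSpan hx hy
  have key : ∀ a ∈ A, ∀ p q, pb.bracket (a * p) q ∈ L := by
    intro a ha p q; exact pb.key_mem hL (hA ▸ ha) p q
  have alt2 : ∀ a ∈ A, ∀ b ∈ A, ∀ p q : P,
      pb.bracket a p * pb.bracket b q + pb.bracket a q * pb.bracket b p = 0 := by
    intro a ha b hb p q
    have h := hab b hb _ (hAL a ha (p * q))
    have k1 := hab b hb _ (hAL a ha p)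
    have k2 := hab b hb _ (hAL a ha q)
    simp only [pb.leib_r, pb.add_right, k1, k2] at h
    linear_combination h
  have kB : ∀ c ∈ A, ∀ l ∈ L, ∀ a ∈ A, ∀ p ∈ L, ∀ q,
      pb.bracket c l * pb.bracket (pb.bracket a p) q = 0 := by
    intro c hc l hl a ha p hp q
    have h := hab c hc _ (hLL _ (key a ha p q) l hl)
    have k1 := hab c hc a ha
    have k2 := hab c hc _ (hLL _ (hL p hp q) l hl)
    have k3 := hab c hc _ (hAL a ha l)
    have k4 := hab c hc _ (hAL a ha q)
    have k5 := hab c hc _ (hAL _ (hAL a ha q) l)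
    have k6 := hab c hc _ (hLL p hp l hl)
    simp only [pb.leibniz, pb.leib_r, pb.add_left, pb.add_right, k1, k2, k3, k4, k5, k6] at h
    have m1 := alt2 a ha c hc l (pb.bracket p q)
    have m2 := alt2 c hc _ (hAL a ha q) p l
    have j := pb.jac a p q
    rw [pb.anti p (pb.bracket a q)] at j
    linear_combination (-h) + m1 + m2 - pb.bracket c l * j
  have kill : ∀ a1 ∈ A, ∀ l1 ∈ L, ∀ a2 ∈ A, ∀ l2 ∈ L, ∀ a ∈ A, ∀ x ∈ L, ∀ e ∈ A, ∀ s,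
      (pb.bracket a1 l1 * pb.bracket a2 l2) * (pb.bracket a x * pb.bracket e s) = 0 := by
    intro a1 ha1 l1 hl1 a2 ha2 l2 hl2 a ha x hx e he s
    subst hA
    refine pb.alt_kill _ ?_ ?_ ha he hx s
    · intro a ha b hb p q
      rw [alt2 a ha b hb, mul_zero]
    · intro a ha x hx x' hx' y hy s
      set b := pb.bracket a1 l1 with hb
      have hbA : b ∈ pb.lieSpan L L := hAL a1 ha1 l1
      have h := kB a2 ha2 l2 hl2 a ha _ (key b hbA (x * x') y) s
      have n1 := hab a ha b hbA
      have n2 := hab a ha _ (hAL b hbA y)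
      have n3 := hab a ha _ (hLL x hx y hy)
      have n4 := hab a ha _ (hLL x' hx' y hy)
      simp only [pb.leibniz, pb.leib_r, pb.add_left, pb.add_right, n1, n2, n3, n4,
        mul_zero, zero_add, add_zero] at h
      have z1 := kB a2 ha2 l2 hl2 a1 ha1 l1 hl1 s
      have z2 := kB a2 ha2 l2 hl2 a1 ha1 l1 hl1 y
      have z3 := kB a2 ha2 l2 hl2 a ha x hx s
      have z4 := kB a2 ha2 l2 hl2 a ha x' hx' s
      have z5 := kB a2 ha2 l2 hl2 b hbA y hy s
      rw [← hb] at z1 z2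
      linear_combination h
        - (pb.bracket a x * pb.bracket x' y + pb.bracket a x' * pb.bracket x y) * z1
        - (x * pb.bracket (pb.bracket a x') s + pb.bracket a x' * pb.bracket x s
          + x' * pb.bracket (pb.bracket a x) s + pb.bracket a x * pb.bracket x' s) * z2
        - b * pb.bracket x' y * z3 - b * pb.bracket x y * z4
        - (x * pb.bracket a x' + x' * pb.bracket a x) * z5
  have hB : (pb.brId A L) ^ 3 * pb.brId A ⊤ = ⊥ := by
    rw [eq_bot_iff, pow_succ, pow_two, mul_assoc]
    unfold brId
    rw [Ideal.span_mul_span', Ideal.span_mul_span', Ideal.span_mul_span', Ideal.span_le]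
    rintro _ ⟨_, ⟨_, ⟨a1, ha1, l1, hl1, rfl⟩, _, ⟨a2, ha2, l2, hl2, rfl⟩, rfl⟩,
      _, ⟨_, ⟨a, ha, x, hx, rfl⟩, _, ⟨e, he, s, -, rfl⟩, rfl⟩, rfl⟩
    exact kill a1 ha1 l1 hl1 a2 ha2 l2 hl2 a ha x hx e he s
  have hC : pb.brId A A = ⊥ := by
    rw [eq_bot_iff]
    unfold brId
    rw [Ideal.span_le]
    rintro _ ⟨a, ha, b, hb, rfl⟩
    exact hab a ha b hb
  have h3 := pb.cube_le hL hA
  rw [hC, sup_bot_eq] at h3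
  rw [eq_bot_iff, ← hB]
  calc pb.brId A ⊤ ^ 10 = (pb.brId A ⊤ ^ 3) ^ 3 * pb.brId A ⊤ := by ring
    _ ≤ _ := Ideal.mul_mono_left (Ideal.pow_right_mono h3 3)


/-- Quotient bracket. -/
noncomputable def quot (N : Ideal P) (hN : ∀ x ∈ N, ∀ p : P, pb.bracket x p ∈ N) :
    PoissonBracket F (P ⧸ N) :=
  have key : ∀ a b : P, Ideal.Quotient.mk N (pb.bracket
      (Quotient.out (Ideal.Quotient.mk N a)) (Quotient.out (Ideal.Quotient.mk N b)))
      = Ideal.Quotient.mk N (pb.bracket a b) := by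
    intro a b
    have e1 : Ideal.Quotient.mk N (Quotient.out (Ideal.Quotient.mk N a)) = Ideal.Quotient.mk N a :=
      Quotient.out_eq _
    have e2 : Ideal.Quotient.mk N (Quotient.out (Ideal.Quotient.mk N b)) = Ideal.Quotient.mk N b :=
      Quotient.out_eq _
    generalize Quotient.out (Ideal.Quotient.mk N a) = a' at *
    generalize Quotient.out (Ideal.Quotient.mk N b) = b' at *
    rw [Ideal.Quotient.eq] at *
    have k1 := hN _ e1 b'
    have k2 := hN _ e2 a
    rw [sub_eq_add_neg, pb.add_left, pb.neg_l] at k1 k2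
    have := Ideal.sub_mem _ k1 k2
    rw [pb.anti b' a, pb.anti b a] at this
    convert this using 1
    ring
  { bracket := fun x y => Ideal.Quotient.mk N (pb.bracket (Quotient.out x) (Quotient.out y))
    add_left := by
      intro a b c
      obtain ⟨a, rfl⟩ := Ideal.Quotient.mk_surjective a
      obtain ⟨b, rfl⟩ := Ideal.Quotient.mk_surjective b
      obtain ⟨c, rfl⟩ := Ideal.Quotient.mk_surjective c
      rw [← map_add, key, key, key, pb.add_left, map_add]
    smul_left := by
      intro r a b
      obtain ⟨a, rfl⟩ := Ideal.Quotient.mk_surjective a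
      obtain ⟨b, rfl⟩ := Ideal.Quotient.mk_surjective b
      have e : ∀ z : P, r • Ideal.Quotient.mk N z = Ideal.Quotient.mk N (r • z) := fun z => rfl
      rw [e, key, key, pb.smul_left, e]
    add_right := by
      intro a b c
      obtain ⟨a, rfl⟩ := Ideal.Quotient.mk_surjective a
      obtain ⟨b, rfl⟩ := Ideal.Quotient.mk_surjective b
      obtain ⟨c, rfl⟩ := Ideal.Quotient.mk_surjective c
      rw [← map_add, key, key, key, pb.add_right, map_add]
    smul_right := by
      intro r a b
      obtain ⟨a, rfl⟩ := Ideal.Quotient.mk_surjective a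
      obtain ⟨b, rfl⟩ := Ideal.Quotient.mk_surjective b
      have e : ∀ z : P, r • Ideal.Quotient.mk N z = Ideal.Quotient.mk N (r • z) := fun z => rfl
      rw [e, key, key, pb.smul_right, e]
    alt := by
      intro a
      obtain ⟨a, rfl⟩ := Ideal.Quotient.mk_surjective a
      rw [key, pb.alt, map_zero]
    jacobi := by
      intro a b c
      obtain ⟨a, rfl⟩ := Ideal.Quotient.mk_surjective a
      obtain ⟨b, rfl⟩ := Ideal.Quotient.mk_surjective b
      obtain ⟨c, rfl⟩ := Ideal.Quotient.mk_surjective c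
      rw [key a b, key b c, key c a, key (pb.bracket a b) c, key (pb.bracket b c) a,
        key (pb.bracket c a) b, ← map_add, ← map_add, pb.jacobi, map_zero]
    leibniz := by
      intro a b c
      obtain ⟨a, rfl⟩ := Ideal.Quotient.mk_surjective a
      obtain ⟨b, rfl⟩ := Ideal.Quotient.mk_surjective b
      obtain ⟨c, rfl⟩ := Ideal.Quotient.mk_surjective c
      rw [← map_mul, key, key, key, pb.leibniz, map_add, map_mul, map_mul] }

theorem quot_mk (N : Ideal P) (hN : ∀ x ∈ N, ∀ p : P, pb.bracket x p ∈ N) (a b : P) :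
    (pb.quot N hN).bracket (Ideal.Quotient.mk N a) (Ideal.Quotient.mk N b)
      = Ideal.Quotient.mk N (pb.bracket a b) := by
  change Ideal.Quotient.mk N (pb.bracket
      (Quotient.out (Ideal.Quotient.mk N a)) (Quotient.out (Ideal.Quotient.mk N b))) = _
  have e1 : Ideal.Quotient.mk N (Quotient.out (Ideal.Quotient.mk N a)) = Ideal.Quotient.mk N a :=
    Quotient.out_eq _
  have e2 : Ideal.Quotient.mk N (Quotient.out (Ideal.Quotient.mk N b)) = Ideal.Quotient.mk N b :=
    Quotient.out_eq _
  generalize Quotient.out (Ideal.Quotient.mk N a) = a' at *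
  generalize Quotient.out (Ideal.Quotient.mk N b) = b' at *
  rw [Ideal.Quotient.eq] at *
  have k1 := hN _ e1 b'
  have k2 := hN _ e2 a
  rw [sub_eq_add_neg, pb.add_left, pb.neg_l] at k1 k2
  have := Ideal.sub_mem _ k1 k2
  rw [pb.anti b' a, pb.anti b a] at this
  convert this using 1
  ring

/-- image of a subspace in the quotient -/
def im (N : Ideal P) (A : Submodule F P) : Submodule F (P ⧸ N) :=
  A.map (Ideal.Quotient.mkₐ F N).toLinearMap

theorem mem_im {N : Ideal P} {A : Submodule F P} {z : P ⧸ N} :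
    z ∈ im N A ↔ ∃ a ∈ A, Ideal.Quotient.mk N a = z := Iff.rfl

theorem im_top (N : Ideal P) : im N (⊤ : Submodule F P) = ⊤ := by
  rw [eq_top_iff]
  intro z _
  obtain ⟨a, rfl⟩ := Ideal.Quotient.mk_surjective z
  exact mem_im.2 ⟨a, trivial, rfl⟩

theorem im_lieSpan (N : Ideal P) (hN : ∀ x ∈ N, ∀ p : P, pb.bracket x p ∈ N)
    (A B : Submodule F P) :
    im N (pb.lieSpan A B) = (pb.quot N hN).lieSpan (im N A) (im N B) := by
  unfold im lieSpan
  rw [Submodule.map_span]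
  congr 1
  ext z
  constructor
  · rintro ⟨_, ⟨a, ha, b, hb, rfl⟩, rfl⟩
    exact ⟨_, ⟨a, ha, rfl⟩, _, ⟨b, hb, rfl⟩, (pb.quot_mk N hN a b).symm⟩
  · rintro ⟨_, ⟨a, ha, rfl⟩, _, ⟨b, hb, rfl⟩, rfl⟩
    exact ⟨_, ⟨a, ha, b, hb, rfl⟩, (pb.quot_mk N hN a b).symm⟩

theorem im_lieId {N : Ideal P} (hN : ∀ x ∈ N, ∀ p : P, pb.bracket x p ∈ N)
    {A : Submodule F P} (hA : pb.LieId A) : (pb.quot N hN).LieId (im N A) := by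
  rintro _ ⟨a, ha, rfl⟩ p
  obtain ⟨p, rfl⟩ := Ideal.Quotient.mk_surjective p
  exact ⟨_, hA a ha p, (pb.quot_mk N hN a p).symm⟩

theorem map_brId (N : Ideal P) (hN : ∀ x ∈ N, ∀ p : P, pb.bracket x p ∈ N)
    (A B : Submodule F P) :
    (pb.brId A B).map (Ideal.Quotient.mk N) = (pb.quot N hN).brId (im N A) (im N B) := by
  unfold brId
  rw [Ideal.map_span]
  congr 1
  ext z
  constructor
  · rintro ⟨_, ⟨a, ha, b, hb, rfl⟩, rfl⟩
    exact ⟨_, ⟨a, ha, rfl⟩, _, ⟨b, hb, rfl⟩, (pb.quot_mk N hN a b).symm⟩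
  · rintro ⟨_, ⟨a, ha, rfl⟩, _, ⟨b, hb, rfl⟩, rfl⟩
    exact ⟨_, ⟨a, ha, b, hb, rfl⟩, (pb.quot_mk N hN a b).symm⟩

/-- descend a nilpotency statement from the quotient -/
theorem pow_le_of_quot (N : Ideal P) (hN : ∀ x ∈ N, ∀ p : P, pb.bracket x p ∈ N)
    (A : Submodule F P) (m : ℕ) (h : (pb.quot N hN).brId (im N A) ⊤ ^ m = ⊥) :
    pb.brId A ⊤ ^ m ≤ N := by
  rw [← im_top, ← pb.map_brId, ← Ideal.map_pow, Ideal.map_eq_bot_iff_le_ker,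
    Ideal.mk_ker] at h
  exact h

/-- Centre-by-abelian case. -/
theorem core2 {L A : Submodule F P} (hL : pb.LieId L) (hLP : L ≤ pb.lieSpan ⊤ ⊤)
    (hA : A = pb.lieSpan L L)
    (hcen : ∀ a ∈ A, ∀ b ∈ A, ∀ p, pb.bracket (pb.bracket a b) p = 0) :
    pb.brId A ⊤ ^ 15 = ⊥ := by
  have hAL : pb.LieId A := hA ▸ hL.span hL
  have hLL : ∀ x ∈ L, ∀ y ∈ L, pb.bracket x y ∈ A := by
    intro x hx y hy; rw [hA]; exact pb.mem_lieSpan hx hy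
  have hcen' : ∀ a ∈ A, ∀ b ∈ A, ∀ p, pb.bracket p (pb.bracket a b) = 0 := by
    intro a ha b hb p; rw [pb.anti, hcen a ha b hb, neg_zero]
  -- `c {p,q} ∈ A`
  have keyA : ∀ a ∈ A, ∀ b ∈ A, ∀ p q, pb.bracket a b * pb.bracket p q ∈ A := by
    intro a ha b hb p q
    have h := pb.key_mem hAL (pb.mem_lieSpan ha hb) p q
    rwa [pb.leibniz, hcen a ha b hb, mul_zero, add_zero] at h
  have keyA' : ∀ a ∈ A, ∀ b ∈ A, ∀ x ∈ pb.lieSpan (⊤ : Submodule F P) ⊤,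
      pb.bracket a b * x ∈ A := by
    intro a ha b hb x hx
    induction hx using Submodule.span_induction with
    | mem x h =>
      obtain ⟨p, -, q, -, rfl⟩ := h
      exact keyA a ha b hb p q
    | zero => rw [mul_zero]; exact A.zero_mem
    | add x y _ _ h1 h2 => rw [mul_add]; exact A.add_mem h1 h2
    | smul r x _ h => rw [mul_smul_comm]; exact A.smul_mem r h
  -- `C² {A,P} = 0`
  have cc : ∀ a ∈ A, ∀ b ∈ A, ∀ a' ∈ A, ∀ b' ∈ A, ∀ e ∈ A, ∀ r,
      pb.bracket a b * pb.bracket a' b' * pb.bracket e r = 0 := by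
    intro a ha b hb a' ha' b' hb' e he r
    rw [hA] at he
    induction he using Submodule.span_induction with
    | mem x h =>
      obtain ⟨x, hx, y, hy, rfl⟩ := h
      have h := hcen _ (keyA' a ha b hb x (hLP hx)) _ (keyA' a' ha' b' hb' y (hLP hy)) r
      simp only [pb.leibniz, pb.leib_r, pb.add_left, hcen a ha b hb, hcen a' ha' b' hb',
        hcen' a' ha' b' hb', pb.zero_l] at h
      linear_combination h
    | zero => rw [pb.zero_l, mul_zero]
    | add x y _ _ h1 h2 => rw [pb.add_left, mul_add, h1, h2, add_zero]
    | smul t x _ h => rw [pb.smul_left, mul_smul_comm, h, smul_zero]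
  -- `C {{A,δ₁},P} = 0`
  have cB : ∀ a ∈ A, ∀ b ∈ A, ∀ e ∈ A, ∀ x ∈ pb.lieSpan (⊤ : Submodule F P) ⊤, ∀ r,
      pb.bracket a b * pb.bracket (pb.bracket e x) r = 0 := by
    intro a ha b hb e he x hx r
    have h := hcen e he _ (keyA' a ha b hb x hx) r
    simp only [pb.leibniz, pb.leib_r, pb.add_left, hcen a ha b hb, hcen' a ha b hb, pb.zero_l] at h
    linear_combination h
  have kill : ∀ a1 ∈ A, ∀ b1 ∈ A, ∀ e0 ∈ A, ∀ r0, ∀ a ∈ A, ∀ x ∈ L, ∀ e ∈ A, ∀ s,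
      (pb.bracket a1 b1 * pb.bracket e0 r0) * (pb.bracket a x * pb.bracket e s) = 0 := by
    intro a1 ha1 b1 hb1 e0 he0 r0 a ha x hx e he s
    subst hA
    have ck : ∀ a ∈ pb.lieSpan L L, ∀ b ∈ pb.lieSpan L L,
        pb.bracket a1 b1 * pb.bracket e0 r0 * pb.bracket a b = 0 := by
      intro a ha b hb
      linear_combination cc a1 ha1 b1 hb1 a ha b hb e0 he0 r0
    refine pb.alt_kill _ ?_ ?_ ha he hx s
    · intro a ha b hb p q
      have h := ck b hb _ (hAL a ha (p * q))
      have k1 := ck b hb _ (hAL a ha p)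
      have k2 := ck b hb _ (hAL a ha q)
      simp only [pb.leib_r, pb.add_right] at h
      linear_combination h - q * k1 - p * k2
    · intro a ha x hx x' hx' y hy s
      have h := cB a1 ha1 b1 hb1 a ha (pb.bracket (x * x') y) (pb.mem_lieSpan trivial trivial) s
      have n3 := hcen a ha _ (hLL x hx y hy) s
      have n4 := hcen a ha _ (hLL x' hx' y hy) s
      simp only [pb.leibniz, pb.leib_r, pb.add_left, pb.add_right, n3, n4,
        mul_zero, zero_add, add_zero] at h
      have z3 := cB a1 ha1 b1 hb1 a ha x (hLP hx) s
      have z4 := cB a1 ha1 b1 hb1 a ha x' (hLP hx') s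
      have y3 := ck a ha _ (hLL x hx y hy)
      have y4 := ck a ha _ (hLL x' hx' y hy)
      linear_combination pb.bracket e0 r0 * h
        - pb.bracket e0 r0 * pb.bracket x' y * z3 - pb.bracket e0 r0 * pb.bracket x y * z4
        - pb.bracket x' s * y3 - pb.bracket x s * y4
  set IA := pb.brId A ⊤ with hIA
  set IB := pb.brId A L with hIB
  set IC := pb.brId A A with hIC
  have e1 : IC * IA * (IB * IA) = ⊥ := by
    rw [eq_bot_iff, hIA, hIB, hIC]
    unfold brId
    rw [Ideal.span_mul_span', Ideal.span_mul_span', Ideal.span_mul_span', Ideal.span_le]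
    rintro _ ⟨_, ⟨_, ⟨a1, ha1, b1, hb1, rfl⟩, _, ⟨e0, he0, r0, -, rfl⟩, rfl⟩,
      _, ⟨_, ⟨a, ha, x, hx, rfl⟩, _, ⟨e, he, s, -, rfl⟩, rfl⟩, rfl⟩
    exact kill a1 ha1 b1 hb1 e0 he0 r0 a ha x hx e he s
  have e2 : IC * IC * IA = ⊥ := by
    rw [eq_bot_iff, hIA, hIC]
    unfold brId
    rw [Ideal.span_mul_span', Ideal.span_mul_span', Ideal.span_le]
    rintro _ ⟨_, ⟨_, ⟨a1, ha1, b1, hb1, rfl⟩, _, ⟨a2, ha2, b2, hb2, rfl⟩, rfl⟩,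
      _, ⟨e, he, s, -, rfl⟩, rfl⟩
    exact cc a1 ha1 b1 hb1 a2 ha2 b2 hb2 e he s
  have e3 : IA ^ 3 ≤ IB ⊔ IC := pb.cube_le hL hA
  have e4 : IA ^ 10 ≤ IC := by
    have hN := pb.brId_closed hAL hAL
    refine pb.pow_le_of_quot IC hN A 10 ?_
    refine core1 _ (pb.im_lieId hN hL) ((congrArg (im IC) hA).trans (pb.im_lieSpan IC hN L L)) ?_
    rintro _ ⟨a, ha, rfl⟩ _ ⟨b, hb, rfl⟩
    have := pb.quot_mk IC hN a b
    rw [Ideal.Quotient.eq_zero_iff_mem.2 (pb.mem_brId ha hb)] at this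
    exact this
  rw [eq_bot_iff]
  calc IA ^ 15 = IA ^ 10 * IA ^ 3 * (IA * IA) := by ring
    _ ≤ IC * (IB ⊔ IC) * (IA * IA) := Ideal.mul_mono_left (Ideal.mul_mono e4 e3)
    _ = IC * IA * (IB * IA) + IC * IC * IA * IA := by
      rw [← Ideal.add_eq_sup]; ring
    _ ≤ ⊥ := by rw [e1, e2]; simp

theorem step (k : ℕ) : pb.brId (pb.dseries ⊤ (k + 2)) ⊤ ^ 15 ≤ pb.brId (pb.dseries ⊤ (k + 3)) ⊤ := by
  have hN := pb.brId_closed (pb.lieId_dseries (k + 3)) pb.lieId_top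
  refine pb.pow_le_of_quot _ hN _ 15 ?_
  have e : ∀ m, im (pb.brId (pb.dseries ⊤ (k + 3)) ⊤) (pb.dseries ⊤ (m + 1)) =
      (pb.quot _ hN).lieSpan (im _ (pb.dseries ⊤ m)) (im _ (pb.dseries ⊤ m)) :=
    fun m => pb.im_lieSpan _ hN _ _
  refine core2 _ (pb.im_lieId hN (pb.lieId_dseries (k + 1))) ?_ (e (k + 1)) ?_
  · rw [e k]
    refine Submodule.span_mono ?_
    rintro _ ⟨a, -, b, -, rfl⟩
    exact ⟨a, trivial, b, trivial, rfl⟩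
  · rintro _ ⟨a, ha, rfl⟩ _ ⟨b, hb, rfl⟩ p
    obtain ⟨p, rfl⟩ := Ideal.Quotient.mk_surjective p
    have h1 := pb.quot_mk _ hN a b
    have h2 := pb.quot_mk _ hN (pb.bracket a b) p
    have h3 : pb.bracket (pb.bracket a b) p ∈ pb.brId (pb.dseries ⊤ (k + 3)) ⊤ :=
      pb.mem_brId (pb.mem_lieSpan ha hb) trivial
    rw [Ideal.Quotient.eq_zero_iff_mem.2 h3, ← h1] at h2
    exact h2

theorem steps (k : ℕ) :
    pb.brId (pb.dseries ⊤ 2) ⊤ ^ (15 ^ k) ≤ pb.brId (pb.dseries ⊤ (k + 2)) ⊤ := by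
  induction k with
  | zero => simp
  | succ k ih =>
    rw [pow_succ, pow_mul]
    exact (Ideal.pow_right_mono ih 15).trans (pb.step k)

end basics

end PoissonBracket

open PoissonBracket

/-- If `P` is solvable of derived length `n ≥ 2`, then `{δ₂(P), P}^t = 0` where
`t = 15^(n-2) + (3/2)·(15^(n-2) - 1)`. -/
theorem bracket_dseries_two_top_pow_eq_bot
    {F P : Type*} [Field F] [CommRing P] [Algebra F P]
    (pb : PoissonBracket F P) (n : ℕ) (hn : 2 ≤ n)
    (hzero : pb.dseries ⊤ n = ⊥) (hmin : pb.dseries ⊤ (n - 1) ≠ ⊥) :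
    pb.lieSpan (pb.dseries ⊤ 2) ⊤ ^ (15 ^ (n - 2) + 3 * (15 ^ (n - 2) - 1) / 2) = ⊥ := by
  obtain ⟨k, rfl⟩ := Nat.exists_eq_add_of_le' hn
  rw [Nat.add_sub_cancel]
  have h0 : pb.brId (pb.dseries ⊤ (k + 2)) ⊤ = ⊥ := by
    rw [hzero, eq_bot_iff]
    unfold brId
    rw [Ideal.span_le]
    rintro _ ⟨a, ha, b, -, rfl⟩
    rw [Submodule.mem_bot] at ha
    subst ha
    exact pb.zero_l b
  have h1 := pb.steps k
  rw [h0, le_bot_iff] at h1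
  have hle : ∀ m : ℕ, ∀ x ∈ pb.lieSpan (pb.dseries ⊤ 2) ⊤ ^ m,
      x ∈ pb.brId (pb.dseries ⊤ 2) ⊤ ^ m := by
    have hb : ∀ x ∈ pb.lieSpan (pb.dseries ⊤ 2) ⊤, x ∈ pb.brId (pb.dseries ⊤ 2) ⊤ := by
      intro x hx
      induction hx using Submodule.span_induction with
      | mem x h => exact Ideal.subset_span h
      | zero => exact Ideal.zero_mem _
      | add x y _ _ h1 h2 => exact Ideal.add_mem _ h1 h2
      | smul r x _ h =>
        rw [Algebra.smul_def]
        exact Ideal.mul_mem_left _ _ h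
    intro m
    induction m with
    | zero => intro x _; simp
    | succ m ih =>
      intro x hx
      rw [pow_succ] at hx ⊢
      induction hx using Submodule.mul_induction_on' with
      | mem_mul_mem a ha b hb' => exact Ideal.mul_mem_mul (ih a ha) (hb b hb')
      | add a _ b _ h1 h2 => exact Ideal.add_mem _ h1 h2
  rw [eq_bot_iff]
  intro x hx
  have := hle _ x hx
  rw [pow_add, h1, Ideal.bot_mul] at this
  exact this
end
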